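/- arXiv:1709.00761 — 3 statements merged into one kernel-verified Lean document; each statement's English description precedes it below -/
import Mathlib

section
/- Let z₀ = x₀ + iy₀ and z₁ = x₁ + iy₁ be points of the hyperbolic upper half-plane ℍ (so y₀, y₁ > 0), let τ > 0 and let c₆ ∈ (0, y₀). If |x₁ − x₀| ≤ τ and |y₁ − y₀| ≥ c₆, then d_ℍ(z₁, z₀) ≤ 2·log(10·√(τ²/c₆² + 1)) + |log(y₁/y₀)|. -/
open UpperHalfPlane

/-- **The distance estimate of Proposition 3.4 (J. Rowlett).** Let `z₀ = x₀ + iy₀` and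
`z₁ = x₁ + iy₁` be points of the hyperbolic upper half-plane `ℍ` (with its hyperbolic
distance `d_ℍ`), let `τ > 0` and `c₆ ∈ (0, y₀)`. If `|x₁ − x₀| ≤ τ` and `|y₁ − y₀| ≥ c₆`,
then `d_ℍ(z₁, z₀) ≤ 2·log(10·√(τ²/c₆² + 1)) + |log(y₁/y₀)|`. -/
theorem dist_le_of_re_close_im_far
    (z₀ z₁ : ℍ) (τ c₆ : ℝ) (hτ : 0 < τ) (hc₆ : 0 < c₆) (hc₆' : c₆ < z₀.im)
    (hre : |z₁.re - z₀.re| ≤ τ) (him : c₆ ≤ |z₁.im - z₀.im|) :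
    dist z₁ z₀ ≤
      2 * Real.log (10 * Real.sqrt (τ ^ 2 / c₆ ^ 2 + 1)) + |Real.log (z₁.im / z₀.im)| := by
  set K : ℝ := τ ^ 2 / c₆ ^ 2 + 1 with hK
  set M : ℝ := Real.exp |Real.log (z₁.im / z₀.im)| with hM
  have h₀ := z₀.im_pos
  have h₁ := z₁.im_pos
  have hK1 : 1 ≤ K := by
    have : 0 ≤ τ ^ 2 / c₆ ^ 2 := by positivity
    linarith
  have hM1 : 1 ≤ M := Real.one_le_exp (abs_nonneg _)
  have hM₁ : z₁.im / z₀.im ≤ M := by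
    rw [hM, ← Real.log_le_iff_le_exp (by positivity)]
    exact le_abs_self _
  have hM₀ : z₀.im / z₁.im ≤ M := by
    rw [hM, ← Real.log_le_iff_le_exp (by positivity), ← inv_div, Real.log_inv]
    exact neg_le_abs _
  have hdx : (z₁.re - z₀.re) ^ 2 ≤ τ ^ 2 := sq_le_sq' (abs_le.mp hre).1 (abs_le.mp hre).2
  have hdy : c₆ ^ 2 ≤ (z₁.im - z₀.im) ^ 2 := by
    rw [← sq_abs (z₁.im - z₀.im)]
    gcongr
  have hτdy : τ ^ 2 ≤ (K - 1) * (z₁.im - z₀.im) ^ 2 := by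
    calc τ ^ 2 = (K - 1) * c₆ ^ 2 := by rw [hK]; field_simp; ring
      _ ≤ _ := mul_le_mul_of_nonneg_left hdy (by linarith)
  have hcosh : 2 * Real.cosh (dist z₁ z₀) ≤
      2 + K * (z₁.im / z₀.im + z₀.im / z₁.im - 2) := by
    have hy : z₁.im / z₀.im + z₀.im / z₁.im - 2 =
        (z₁.im - z₀.im) ^ 2 / (z₁.im * z₀.im) := by
      field_simp
      ring
    have hc : 2 * Real.cosh (dist z₁ z₀) =
        2 + ((z₁.re - z₀.re) ^ 2 + (z₁.im - z₀.im) ^ 2) / (z₁.im * z₀.im) := by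
      rw [UpperHalfPlane.cosh_dist']
      field_simp
      ring
    rw [hc, hy, ← mul_div_assoc]
    gcongr
    linarith
  have hexp : Real.exp (dist z₁ z₀) ≤ 100 * K * M := by
    have hle : Real.exp (dist z₁ z₀) ≤ 2 * Real.cosh (dist z₁ z₀) := by
      rw [Real.cosh_eq]
      linarith [Real.exp_pos (-dist z₁ z₀)]
    have hKM : K * (z₁.im / z₀.im + z₀.im / z₁.im - 2) ≤ K * (2 * M - 2) := by
      gcongr
      linarith
    nlinarith
  rw [← Real.exp_le_exp, Real.exp_add, two_mul, Real.exp_add,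
    Real.exp_log (by positivity)]
  calc Real.exp (dist z₁ z₀) ≤ 100 * K * M := hexp
    _ = 10 * √K * (10 * √K) * M := by
      rw [mul_mul_mul_comm, Real.mul_self_sqrt (by linarith)]
      norm_num
end

section
/- Let y > 0, r ∈ ℕ, and s ∈ ℂ with Re s > (r+1)/2. Then the function a ↦ ∫_ℝ e^{2πiax}(x² + y²)^{−s} dx is r times differentiable on ℝ, and for every a ∈ ℝ its r-th derivative at a equals (2πi)^r · ∫_ℝ x^r e^{2πiax}(x² + y²)^{−s} dx. Equivalently, Φ(r, a, y, s) = (2πi)^{−r} · (d^r/da^r) Φ(0, a, y, s), where Φ(p, a, y, s) := ∫_ℝ x^p e^{2πiax}(x² + y²)^{−s} dx. -/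
open MeasureTheory

open scoped FourierTransform

theorem integrable_sq_add_sq_rpow {y t : ℝ} (hy : 0 < y) (ht : 1 < t) :
    Integrable fun x : ℝ ↦ (x ^ 2 + y ^ 2) ^ (-t / 2) := by
  have h : Integrable fun x : ℝ ↦ ((1 : ℝ) + ‖x‖ ^ 2) ^ (-t / 2) :=
    integrable_rpow_neg_one_add_norm_sq (by simpa using ht)
  convert! (h.comp_div hy.ne').const_mul ((y ^ 2) ^ (-t / 2)) using 2 with x
  rw [← Real.mul_rpow (by positivity) (by positivity)]
  congr 1
  rw [Real.norm_eq_abs, sq_abs]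
  field_simp
  ring

theorem continuous_cpow_sq_add_sq {y : ℝ} (hy : 0 < y) (s : ℂ) :
    Continuous fun x : ℝ ↦ (((x ^ 2 + y ^ 2 : ℝ) : ℂ) ^ s)⁻¹ := by
  have hpos (x : ℝ) : 0 < x ^ 2 + y ^ 2 := by positivity
  refine Continuous.inv₀ (Continuous.cpow (by fun_prop) continuous_const
    fun x ↦ Complex.ofReal_mem_slitPlane.2 (hpos x)) fun x ↦ ?_
  rw [Complex.cpow_ne_zero_iff]
  exact Or.inl (Complex.ofReal_ne_zero.2 (hpos x).ne')

theorem integrable_pow_smul_cpow_sq_add_sq {y : ℝ} (hy : 0 < y) {n : ℕ} {s : ℂ}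
    (hs : ((n : ℝ) + 1) / 2 < s.re) :
    Integrable fun x : ℝ ↦ x ^ n • (((x ^ 2 + y ^ 2 : ℝ) : ℂ) ^ s)⁻¹ := by
  refine (integrable_sq_add_sq_rpow hy (t := 2 * s.re - n) (by linarith)).mono'
    ((continuous_pow n).smul (continuous_cpow_sq_add_sq hy s)).aestronglyMeasurable
    (Filter.Eventually.of_forall fun x ↦ ?_)
  have hpos : 0 < x ^ 2 + y ^ 2 := by positivity
  have hpow : |x| ^ n ≤ (x ^ 2 + y ^ 2) ^ ((n : ℝ) / 2) := by
    rw [show (n : ℝ) / 2 = 1 / 2 * n by ring, Real.rpow_mul hpos.le, ← Real.sqrt_eq_rpow,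
      Real.rpow_natCast]
    gcongr
    exact Real.abs_le_sqrt (by nlinarith [sq_nonneg y])
  calc ‖x ^ n • (((x ^ 2 + y ^ 2 : ℝ) : ℂ) ^ s)⁻¹‖
      = |x| ^ n * (x ^ 2 + y ^ 2) ^ (-s.re) := by
        rw [norm_smul, norm_inv, Complex.norm_cpow_eq_rpow_re_of_pos hpos,
          Real.rpow_neg hpos.le, norm_pow, Real.norm_eq_abs]
    _ ≤ (x ^ 2 + y ^ 2) ^ ((n : ℝ) / 2) * (x ^ 2 + y ^ 2) ^ (-s.re) := by gcongr
    _ = (x ^ 2 + y ^ 2) ^ (-(2 * s.re - n) / 2) := by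
        rw [← Real.rpow_add hpos]
        ring_nf

theorem fourier_pow_smul_of_even {f : ℝ → ℂ} (hf : Function.Even f) (n : ℕ) (a : ℝ) :
    𝓕 (fun x : ℝ ↦ (-2 * Real.pi * Complex.I * x) ^ n • f x) a =
      (2 * Real.pi * Complex.I) ^ n *
        ∫ x : ℝ, (x : ℂ) ^ n * Complex.exp (2 * Real.pi * Complex.I * a * x) * f x := by
  rw [Real.fourier_real_eq_integral_exp_smul, ← integral_neg_eq_self, ← integral_const_mul]
  congr 1 with x
  simp only [hf x, smul_eq_mul, Complex.ofReal_neg, Complex.ofReal_mul, Complex.ofReal_ofNat]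
  rw [show -2 * (Real.pi : ℂ) * Complex.I * -(x : ℂ) = 2 * Real.pi * Complex.I * x by ring,
    show -2 * (Real.pi : ℂ) * -(x : ℂ) * a * Complex.I = 2 * Real.pi * Complex.I * a * x by ring,
    mul_pow _ (x : ℂ)]
  ring



/-- **Differentiation under the integral for `Φ` (Lemma A.1).** Let `y > 0`, `r ∈ ℕ`,
`r ≥ 1`, and `s ∈ ℂ` with `Re s > (r+1)/2`. Then `a ↦ Φ(0, a, y, s) = ∫_ℝ e^{2πiax}(x²+y²)^{−s} dx`
is `r` times differentiable on `ℝ` and for every `a ∈ ℝ` its `r`-th derivative at `a`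
equals `(2πi)^r · Φ(r, a, y, s) = (2πi)^r · ∫_ℝ x^r e^{2πiax}(x²+y²)^{−s} dx`. -/
theorem iteratedDeriv_phi
    (y : ℝ) (hy : 0 < y) (r : ℕ) (hr : 1 ≤ r) (s : ℂ) (hs : ((r : ℝ) + 1) / 2 < s.re)
    (Φ : ℕ → ℝ → ℂ)
    (hΦ : ∀ (p : ℕ) (a : ℝ), Φ p a =
      ∫ x : ℝ, (x : ℂ) ^ p * Complex.exp (2 * Real.pi * Complex.I * a * x) /
        ((x ^ 2 + y ^ 2 : ℝ) : ℂ) ^ s) :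
    (∀ k < r, Differentiable ℝ (iteratedDeriv k (Φ 0))) ∧
      ∀ a : ℝ, iteratedDeriv r (Φ 0) a = (2 * Real.pi * Complex.I) ^ r * Φ r a := by
  set f : ℝ → ℂ := fun x ↦ (((x ^ 2 + y ^ 2 : ℝ) : ℂ) ^ s)⁻¹ with hf
  have heven : Function.Even f := fun x ↦ by simp [hf]
  have hint (n : ℕ) (hn : n ≤ r) : Integrable fun x : ℝ ↦ x ^ n • f x := by
    refine integrable_pow_smul_cpow_sq_add_sq hy (lt_of_le_of_lt ?_ hs)
    gcongr
  have hfourier (n : ℕ) (a : ℝ) :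
      𝓕 (fun x : ℝ ↦ (-2 * Real.pi * Complex.I * x) ^ n • f x) a =
        (2 * Real.pi * Complex.I) ^ n * Φ n a := by
    rw [fourier_pow_smul_of_even heven, hΦ]
    simp only [hf, div_eq_mul_inv]
  have hzero : Φ 0 = 𝓕 f := by
    ext a
    simpa using (hfourier 0 a).symm
  have hsmooth : ContDiff ℝ ((r : ℕ∞) : WithTop ℕ∞) (𝓕 f) := by
    refine Real.contDiff_fourier fun n hn ↦ ?_
    simpa [norm_smul] using (hint n (by exact_mod_cast hn)).norm
  refine ⟨fun k hk ↦ ?_, fun a ↦ ?_⟩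
  · rw [hzero]
    exact hsmooth.differentiable_iteratedDeriv k (by exact_mod_cast hk)
  · rw [hzero, Real.iteratedDeriv_fourier (N := r) (fun n hn ↦ hint n (by exact_mod_cast hn)) le_rfl,
      hfourier]
end

section
/- Let y > 0, α ∈ ℝ, c > 0, k ∈ ℕ₀, μ ∈ [0,1), and s ∈ ℂ with Re s > k + 1. For m ∈ ℤ let binom(m,k) = m(m−1)⋯(m−k+1)/k! denote the generalized binomial coefficient, and let b₀(α,k), …, b_k(α,k) be the unique real numbers such that binom(u−α, k) = Σ_{p=0}^k b_p(α,k)·u^p for all u ∈ ℝ. Then the series Σ_{m∈ℤ} ( y / (c²((α+m)² + y²)) )^s · binom(m,k) · e^{2πi(m−k)μ} converges absolutely and equals Σ_{ℓ∈ℤ} e^{−2πikμ} · e^{2πiα(ℓ−μ)} · (y^s/c^{2s}) · Σ_{p=0}^k b_p(α,k) · Φ(p, μ−ℓ, y, s), where Φ(p, a, y, s) = ∫_ℝ x^p e^{2πiax}(x² + y²)^{−s} dx. -/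
open MeasureTheory
open Filter Asymptotics FourierTransform

/-- The kernel `x ^ p (x² + y²)^(-s)`. -/
noncomputable def powKernel (y : ℝ) (p : ℕ) (s : ℂ) (x : ℝ) : ℂ :=
  (x : ℂ) ^ p * ((x ^ 2 + y ^ 2 : ℝ) : ℂ) ^ (-s)

lemma hasDerivAt_powKernel {y : ℝ} (hy : 0 < y) (p : ℕ) (s : ℂ) (x : ℝ) :
    HasDerivAt (powKernel y p s)
      (p * powKernel y (p - 1) s x + (-2 * s) * powKernel y (p + 1) (s + 1) x) x := by
  have hpos : 0 < x ^ 2 + y ^ 2 := by positivity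
  have h₁ : HasDerivAt (fun x : ℝ => (x : ℂ) ^ p) (p * (x : ℂ) ^ (p - 1)) x :=
    (hasDerivAt_pow p (x : ℂ)).comp_ofReal
  have h₂ : HasDerivAt (fun x : ℝ => ((x ^ 2 + y ^ 2 : ℝ) : ℂ)) ((2 * x : ℝ) : ℂ) x := by
    have := ((hasDerivAt_pow 2 x).add_const (y ^ 2)).ofReal_comp
    simpa using this
  have h₃ : HasDerivAt (fun x : ℝ => ((x ^ 2 + y ^ 2 : ℝ) : ℂ) ^ (-s))
      (-s * ((x ^ 2 + y ^ 2 : ℝ) : ℂ) ^ (-s - 1) * ((2 * x : ℝ) : ℂ)) x :=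
    HasDerivAt.comp (h₂ := fun z : ℂ => z ^ (-s)) x (Complex.hasStrictDerivAt_cpow_const
      (Complex.ofReal_mem_slitPlane.2 hpos)).hasDerivAt h₂
  refine (h₁.mul h₃).congr_deriv ?_
  simp only [powKernel, neg_add, ← sub_eq_add_neg]
  push_cast
  ring

lemma continuous_powKernel {y : ℝ} (hy : 0 < y) (p : ℕ) (s : ℂ) :
    Continuous (powKernel y p s) :=
  continuous_iff_continuousAt.2 fun x => (hasDerivAt_powKernel hy p s x).continuousAt

lemma exists_norm_powKernel_le {y : ℝ} (hy : 0 < y) {p : ℕ} {s : ℂ} (hs : p + 2 ≤ 2 * s.re) :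
    ∃ C, ∀ x, ‖powKernel y p s x‖ ≤ C * (1 + x ^ 2)⁻¹ := by
  have hσ : 0 ≤ s.re := by linarith [p.cast_nonneg (α := ℝ)]
  have hm : 0 < min 1 (y ^ 2) := by positivity
  refine ⟨min 1 (y ^ 2) ^ (-s.re), fun x => ?_⟩
  have hpos : 0 < x ^ 2 + y ^ 2 := by positivity
  have hx : 0 < 1 + x ^ 2 := by positivity
  have hle : min 1 (y ^ 2) * (1 + x ^ 2) ≤ x ^ 2 + y ^ 2 := by
    nlinarith [min_le_left 1 (y ^ 2), min_le_right 1 (y ^ 2), sq_nonneg x]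
  have hpow : |x| ^ p ≤ (1 + x ^ 2) ^ ((p : ℝ) / 2) := by
    have : |x| ≤ (1 + x ^ 2) ^ (1 / 2 : ℝ) := by
      rw [← Real.sqrt_eq_rpow]
      exact Real.abs_le_sqrt (by linarith)
    calc |x| ^ p ≤ ((1 + x ^ 2) ^ (1 / 2 : ℝ)) ^ p := by gcongr
      _ = _ := by
        rw [← Real.rpow_natCast, ← Real.rpow_mul hx.le]
        ring_nf
  have hker : (x ^ 2 + y ^ 2) ^ (-s.re) ≤ min 1 (y ^ 2) ^ (-s.re) * (1 + x ^ 2) ^ (-s.re) := by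
    rw [← Real.mul_rpow hm.le hx.le]
    exact Real.rpow_le_rpow_of_nonpos (by positivity) hle (by linarith)
  rw [powKernel, norm_mul, norm_pow, Complex.norm_real, Real.norm_eq_abs,
    Complex.norm_cpow_eq_rpow_re_of_pos hpos, Complex.neg_re]
  calc |x| ^ p * (x ^ 2 + y ^ 2) ^ (-s.re)
      ≤ (1 + x ^ 2) ^ ((p : ℝ) / 2) * (min 1 (y ^ 2) ^ (-s.re) * (1 + x ^ 2) ^ (-s.re)) := by
        gcongr
    _ = min 1 (y ^ 2) ^ (-s.re) * (1 + x ^ 2) ^ ((p : ℝ) / 2 + -s.re) := by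
        rw [Real.rpow_add hx]
        ring
    _ ≤ min 1 (y ^ 2) ^ (-s.re) * (1 + x ^ 2) ^ (-1 : ℝ) := by
        gcongr
        · nlinarith
        · linarith
    _ = _ := by rw [Real.rpow_neg_one]

lemma integrable_powKernel {y : ℝ} (hy : 0 < y) {p : ℕ} {s : ℂ} (hs : p + 2 ≤ 2 * s.re) :
    Integrable (powKernel y p s) := by
  obtain ⟨C, hC⟩ := exists_norm_powKernel_le hy hs
  exact (integrable_inv_one_add_sq.const_mul C).mono'
    (continuous_powKernel hy p s).aestronglyMeasurable (ae_of_all _ hC)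

lemma integrable_exp_smul {f : ℝ → ℂ} (hf : Integrable f) (ξ : ℝ) :
    Integrable fun x : ℝ => Complex.exp (↑(-2 * Real.pi * x * ξ) * Complex.I) • f x := by
  refine hf.bdd_smul (φ := fun x : ℝ =>
    Complex.exp (↑(-2 * Real.pi * x * ξ) * Complex.I)) 1 ?_ (ae_of_all _ fun x => ?_)
  · exact Continuous.aestronglyMeasurable (by fun_prop)
  · rw [Complex.norm_exp_ofReal_mul_I]

lemma two_pi_I_mul_fourier_powKernel {y : ℝ} (hy : 0 < y) {p : ℕ} {s : ℂ} (hs : p + 2 ≤ 2 * s.re)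
    (ξ : ℝ) :
    2 * Real.pi * Complex.I * ξ * 𝓕 (powKernel y p s) ξ =
      p * 𝓕 (powKernel y (p - 1) s) ξ + (-2 * s) * 𝓕 (powKernel y (p + 1) (s + 1)) ξ := by
  have hd : deriv (powKernel y p s) = (p : ℂ) • powKernel y (p - 1) s +
      (-2 * s) • powKernel y (p + 1) (s + 1) := by
    ext x
    exact (hasDerivAt_powKernel hy p s x).deriv
  have hi₁ : Integrable (powKernel y (p - 1) s) := integrable_powKernel hy (by
    have : ((p - 1 : ℕ) : ℝ) ≤ p := by exact_mod_cast Nat.sub_le p 1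
    linarith)
  have hi₂ : Integrable (powKernel y (p + 1) (s + 1)) := integrable_powKernel hy (by
    push_cast
    simp only [Complex.add_re, Complex.one_re]
    linarith)
  have h := congrFun (Real.fourier_deriv (integrable_powKernel hy hs)
    (fun x => (hasDerivAt_powKernel hy p s x).differentiableAt)
    (hd ▸ (hi₁.smul _).add (hi₂.smul _))) ξ
  rw [hd] at h
  rw [smul_eq_mul] at h
  rw [← h]
  rw [Real.fourier_real_eq_integral_exp_smul, Real.fourier_real_eq_integral_exp_smul,
    Real.fourier_real_eq_integral_exp_smul, ← integral_const_mul, ← integral_const_mul,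
    ← integral_add ((integrable_exp_smul hi₁ ξ).const_mul _)
      ((integrable_exp_smul hi₂ ξ).const_mul _)]
  refine integral_congr_ae (ae_of_all _ fun x => ?_)
  simp only [Pi.add_apply, Pi.smul_apply, smul_eq_mul]
  ring

lemma exists_pow_mul_norm_fourier_powKernel_le {y : ℝ} (hy : 0 < y) (N : ℕ) :
    ∀ {p : ℕ} {s : ℂ}, p + 2 ≤ 2 * s.re →
      ∃ C, ∀ ξ, |ξ| ^ N * ‖𝓕 (powKernel y p s) ξ‖ ≤ C := by
  induction N with
  | zero =>
    intro p s hs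
    refine ⟨∫ x, ‖powKernel y p s x‖, fun ξ => ?_⟩
    rw [pow_zero, one_mul]
    exact VectorFourier.norm_fourierIntegral_le_integral_norm _ _ _ _ _
  | succ N ih =>
    intro p s hs
    obtain ⟨C₁, h₁⟩ := @ih (p - 1) s (by
      have : ((p - 1 : ℕ) : ℝ) ≤ p := by exact_mod_cast Nat.sub_le p 1
      linarith)
    obtain ⟨C₂, h₂⟩ := @ih (p + 1) (s + 1) (by
      push_cast
      simp only [Complex.add_re, Complex.one_re]
      linarith)
    refine ⟨p * C₁ + 2 * ‖s‖ * C₂, fun ξ => ?_⟩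
    have hle : |ξ| * ‖𝓕 (powKernel y p s) ξ‖ ≤ p * ‖𝓕 (powKernel y (p - 1) s) ξ‖ +
        2 * ‖s‖ * ‖𝓕 (powKernel y (p + 1) (s + 1)) ξ‖ := by
      calc |ξ| * ‖𝓕 (powKernel y p s) ξ‖
          ≤ 2 * Real.pi * (|ξ| * ‖𝓕 (powKernel y p s) ξ‖) :=
            le_mul_of_one_le_left (by positivity) (by linarith [Real.pi_gt_three])
        _ = ‖2 * Real.pi * Complex.I * ξ * 𝓕 (powKernel y p s) ξ‖ := by
            simp [abs_of_pos Real.pi_pos, mul_assoc]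
        _ ≤ _ := by
            rw [two_pi_I_mul_fourier_powKernel hy hs]
            refine (norm_add_le _ _).trans_eq ?_
            simp
    calc |ξ| ^ (N + 1) * ‖𝓕 (powKernel y p s) ξ‖
        = |ξ| ^ N * (|ξ| * ‖𝓕 (powKernel y p s) ξ‖) := by ring
      _ ≤ |ξ| ^ N * (p * ‖𝓕 (powKernel y (p - 1) s) ξ‖ +
            2 * ‖s‖ * ‖𝓕 (powKernel y (p + 1) (s + 1)) ξ‖) := by gcongr
      _ = p * (|ξ| ^ N * ‖𝓕 (powKernel y (p - 1) s) ξ‖) +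
            2 * ‖s‖ * (|ξ| ^ N * ‖𝓕 (powKernel y (p + 1) (s + 1)) ξ‖) := by ring
      _ ≤ _ := by gcongr <;> apply_assumption

lemma isBigO_inv_one_add_sub_sq (a : ℝ) :
    (fun x : ℝ => (1 + (x - a) ^ 2)⁻¹) =O[cocompact ℝ] fun x : ℝ => |x| ^ (-2 : ℝ) := by
  refine IsBigO.of_bound (2 * (1 + a ^ 2)) ?_
  have h0 : ∀ᶠ x : ℝ in cocompact ℝ, x ≠ 0 := by
    simpa using (isCompact_singleton (x := (0 : ℝ))).compl_mem_cocompact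
  filter_upwards [h0] with x hx
  rw [Real.rpow_neg (abs_nonneg x), Real.rpow_two, sq_abs, norm_inv, norm_inv,
    Real.norm_of_nonneg (by positivity), Real.norm_of_nonneg (by positivity), ← div_eq_mul_inv,
    inv_eq_one_div, div_le_div_iff₀ (by positivity) (by positivity)]
  nlinarith [sq_nonneg (x - 2 * a), mul_nonneg (sq_nonneg a) (sq_nonneg (x - a))]

/-- The twist by `e^{2πiμx}` of a linear combination of the kernels `powKernel y p s`. -/
noncomputable def twistedKernel (y : ℝ) (s : ℂ) (μ : ℝ) (b : ℕ → ℝ) (n : ℕ) (x : ℝ) : ℂ :=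
  Complex.exp (2 * Real.pi * Complex.I * μ * x) * ∑ p ∈ Finset.range n, b p * powKernel y p s x

lemma continuous_twistedKernel {y : ℝ} (hy : 0 < y) (s : ℂ) (μ : ℝ) (b : ℕ → ℝ) (n : ℕ) :
    Continuous (twistedKernel y s μ b n) := by
  have := continuous_powKernel hy (s := s)
  unfold twistedKernel
  fun_prop

lemma isBigO_twistedKernel {y : ℝ} (hy : 0 < y) {s : ℂ} (μ : ℝ) (b : ℕ → ℝ) {n : ℕ}
    (hs : ∀ p < n, p + 2 ≤ 2 * s.re) :
    twistedKernel y s μ b n =O[⊤] fun x : ℝ => (1 + x ^ 2)⁻¹ := by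
  have hsum : (fun x => ∑ p ∈ Finset.range n, b p * powKernel y p s x) =O[⊤]
      fun x : ℝ => (1 + x ^ 2)⁻¹ := by
    refine IsBigO.fun_sum fun p hp => IsBigO.const_mul_left ?_ (b p : ℂ)
    obtain ⟨C, hC⟩ := exists_norm_powKernel_le hy (hs p (Finset.mem_range.1 hp))
    refine .of_bound C (.of_forall fun x => ?_)
    rw [Real.norm_of_nonneg (by positivity)]
    exact hC x
  refine IsBigO.trans (.of_bound 1 (.of_forall fun x => ?_)) hsum
  rw [twistedKernel, norm_mul, Complex.norm_exp]
  simp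

lemma fourier_twistedKernel {y : ℝ} (hy : 0 < y) {s : ℂ} (μ : ℝ) (b : ℕ → ℝ) {n : ℕ}
    (hs : ∀ p < n, p + 2 ≤ 2 * s.re) (ξ : ℝ) :
    𝓕 (twistedKernel y s μ b n) ξ =
      ∑ p ∈ Finset.range n, b p * 𝓕 (powKernel y p s) (ξ - μ) := by
  simp only [Real.fourier_real_eq_integral_exp_smul, ← integral_const_mul]
  rw [← integral_finsetSum _ fun p hp => (integrable_exp_smul
    (integrable_powKernel hy (hs p (Finset.mem_range.1 hp))) (ξ - μ)).const_mul _]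
  refine integral_congr_ae (ae_of_all _ fun x => ?_)
  have hexp : Complex.exp (((-2 * Real.pi * x * (ξ - μ) : ℝ) : ℂ) * Complex.I) =
      Complex.exp (((-2 * Real.pi * x * ξ : ℝ) : ℂ) * Complex.I) *
        Complex.exp (2 * Real.pi * Complex.I * μ * x) := by
    rw [← Complex.exp_add]
    congr 1
    push_cast
    ring
  simp only [twistedKernel, smul_eq_mul, hexp, Finset.mul_sum]
  exact Finset.sum_congr rfl fun p _ => by ring

lemma isBigO_fourier_twistedKernel {y : ℝ} (hy : 0 < y) {s : ℂ} (μ : ℝ) (b : ℕ → ℝ) {n : ℕ}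
    (hs : ∀ p < n, p + 2 ≤ 2 * s.re) :
    𝓕 (twistedKernel y s μ b n) =O[cocompact ℝ] fun x : ℝ => |x| ^ (-2 : ℝ) := by
  rw [funext (fourier_twistedKernel hy μ b hs)]
  refine IsBigO.fun_sum fun p hp => IsBigO.const_mul_left ?_ (b p : ℂ)
  have hp := hs p (Finset.mem_range.1 hp)
  obtain ⟨C₀, h₀⟩ := exists_pow_mul_norm_fourier_powKernel_le hy 0 hp
  obtain ⟨C₂, h₂⟩ := exists_pow_mul_norm_fourier_powKernel_le hy 2 hp
  refine IsBigO.trans (.of_bound (C₀ + C₂) (.of_forall fun x => ?_)) (isBigO_inv_one_add_sub_sq μ)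
  rw [norm_inv, Real.norm_of_nonneg (by positivity), ← div_eq_mul_inv,
    le_div_iff₀ (by positivity)]
  have := h₀ (x - μ)
  have := h₂ (x - μ)
  rw [sq_abs] at this
  linarith



/-- **The Poisson-summation identity in the proof of Theorem 5.2.** Let `y > 0`, `α ∈ ℝ`,
`c > 0`, `k ∈ ℕ₀`, `μ ∈ [0, 1)`, and `s ∈ ℂ` with `Re s > k + 1`. For `m ∈ ℤ` let
`binom(m, k) = m(m−1)⋯(m−k+1)/k!` and let `b₀(α,k), …, b_k(α,k)` be the unique reals with
`binom(u−α, k) = ∑_{p=0}^k b_p(α,k)·u^p` for all `u ∈ ℝ`. Then the series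
`∑_{m ∈ ℤ} (y/(c²((α+m)² + y²)))^s · binom(m,k) · e^{2πi(m−k)μ}` converges absolutely and
equals `∑_{ℓ ∈ ℤ} e^{−2πikμ} · e^{2πiα(ℓ−μ)} · (y^s/c^{2s}) · ∑_{p=0}^k b_p(α,k) · Φ(p, μ−ℓ, y, s)`,
where `Φ(p, a, y, s) = ∫_ℝ x^p e^{2πiax}(x²+y²)^{−s} dx`. -/
theorem poisson_summation_eisenstein_coeff
    (y α c : ℝ) (hy : 0 < y) (hc : 0 < c) (k : ℕ) (μ : ℝ) (hμ : μ ∈ Set.Ico (0 : ℝ) 1)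
    (s : ℂ) (hs : (k : ℝ) + 1 < s.re)
    (b : ℕ → ℝ)
    (hb : ∀ u : ℝ, (∏ i ∈ Finset.range k, (u - α - (i : ℝ))) / (Nat.factorial k : ℝ) =
      ∑ p ∈ Finset.range (k + 1), b p * u ^ p)
    (Φ : ℕ → ℝ → ℂ)
    (hΦ : ∀ (p : ℕ) (a : ℝ), Φ p a =
      ∫ x : ℝ, (x : ℂ) ^ p * Complex.exp (2 * Real.pi * Complex.I * a * x) /
        ((x ^ 2 + y ^ 2 : ℝ) : ℂ) ^ s) :
    Summable (fun m : ℤ =>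
      ‖((y / (c ^ 2 * ((α + (m : ℝ)) ^ 2 + y ^ 2)) : ℝ) : ℂ) ^ s *
        (((∏ i ∈ Finset.range k, ((m : ℝ) - (i : ℝ))) / (Nat.factorial k : ℝ) : ℝ) : ℂ) *
        Complex.exp (2 * Real.pi * Complex.I * ((m : ℝ) - (k : ℝ)) * μ)‖) ∧
    (∑' m : ℤ,
      ((y / (c ^ 2 * ((α + (m : ℝ)) ^ 2 + y ^ 2)) : ℝ) : ℂ) ^ s *
        (((∏ i ∈ Finset.range k, ((m : ℝ) - (i : ℝ))) / (Nat.factorial k : ℝ) : ℝ) : ℂ) *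
        Complex.exp (2 * Real.pi * Complex.I * ((m : ℝ) - (k : ℝ)) * μ)) =
    ∑' l : ℤ,
      Complex.exp (-(2 * Real.pi * Complex.I * (k : ℝ) * μ)) *
        Complex.exp (2 * Real.pi * Complex.I * α * ((l : ℝ) - μ)) *
        ((y : ℂ) ^ s / (c : ℂ) ^ (2 * s)) *
        ∑ p ∈ Finset.range (k + 1), (b p : ℂ) * Φ p (μ - (l : ℝ)) := by
  have hs' : ∀ p < k + 1, (p : ℝ) + 2 ≤ 2 * s.re := fun p hp => by
    have : (p : ℝ) ≤ k := by exact_mod_cast Nat.lt_succ_iff.1 hp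
    linarith [k.cast_nonneg (α := ℝ)]
  set F := twistedKernel y s μ b (k + 1) with hF
  set A : ℂ := Complex.exp (-(2 * Real.pi * Complex.I * (k : ℝ) * μ)) *
    Complex.exp (-(2 * Real.pi * Complex.I * α * μ)) * ((y : ℂ) ^ s / (c : ℂ) ^ (2 * s)) with hA
  have hΦF (p : ℕ) (a : ℝ) : Φ p a = 𝓕 (powKernel y p s) (-a) := by
    rw [hΦ, Real.fourier_real_eq_integral_exp_smul]
    refine integral_congr_ae (ae_of_all _ fun x => ?_)
    simp only [powKernel, smul_eq_mul, Complex.cpow_neg]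
    rw [show ((-2 * Real.pi * x * -a : ℝ) : ℂ) * Complex.I = 2 * Real.pi * Complex.I * a * x by
      push_cast; ring]
    ring
  have hcpow (x : ℝ) : ((y / (c ^ 2 * (x ^ 2 + y ^ 2)) : ℝ) : ℂ) ^ s =
      (y : ℂ) ^ s / (c : ℂ) ^ (2 * s) * ((x ^ 2 + y ^ 2 : ℝ) : ℂ) ^ (-s) := by
    have hpos : 0 < x ^ 2 + y ^ 2 := by positivity
    have hc2 : ((c ^ 2 : ℝ) : ℂ) ^ s = (c : ℂ) ^ (2 * s) := by
      rw [two_mul, Complex.cpow_add _ _ (by exact_mod_cast hc.ne'), sq, Complex.ofReal_mul,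
        Complex.mul_cpow_ofReal_nonneg hc.le hc.le]
    rw [div_eq_mul_inv, Complex.ofReal_mul,
      Complex.mul_cpow_ofReal_nonneg hy.le (by positivity), Complex.ofReal_inv,
      Complex.inv_cpow _ _ (by
        rw [Complex.arg_ofReal_of_nonneg (by positivity)]; exact Real.pi_pos.ne),
      Complex.ofReal_mul, Complex.mul_cpow_ofReal_nonneg (by positivity) hpos.le, hc2,
      Complex.cpow_neg, mul_inv]
    ring
  have hterm (m : ℤ) : ((y / (c ^ 2 * ((α + (m : ℝ)) ^ 2 + y ^ 2)) : ℝ) : ℂ) ^ s *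
        (((∏ i ∈ Finset.range k, ((m : ℝ) - (i : ℝ))) / (Nat.factorial k : ℝ) : ℝ) : ℂ) *
        Complex.exp (2 * Real.pi * Complex.I * ((m : ℝ) - (k : ℝ)) * μ) = A * F (α + m) := by
    have hb' := hb (α + m)
    simp only [add_sub_cancel_left] at hb'
    have hexp : Complex.exp (2 * Real.pi * Complex.I * ((m : ℝ) - (k : ℝ)) * μ) =
        Complex.exp (-(2 * Real.pi * Complex.I * (k : ℝ) * μ)) *
        Complex.exp (-(2 * Real.pi * Complex.I * α * μ)) *
        Complex.exp (2 * Real.pi * Complex.I * μ * ((α + m : ℝ) : ℂ)) := by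
      rw [← Complex.exp_add, ← Complex.exp_add]
      congr 1
      push_cast
      ring
    have hsum : ∑ p ∈ Finset.range (k + 1), (b p : ℂ) * powKernel y p s (α + m) =
        ((∑ p ∈ Finset.range (k + 1), b p * (α + m) ^ p : ℝ) : ℂ) *
          (((α + m) ^ 2 + y ^ 2 : ℝ) : ℂ) ^ (-s) := by
      simp only [powKernel, Complex.ofReal_sum, Finset.sum_mul]
      refine Finset.sum_congr rfl fun p _ => ?_
      push_cast
      ring
    rw [hb', hcpow, hexp, hF, twistedKernel, hsum, hA]
    ring
  have hFO : F =O[⊤] fun x : ℝ => (1 + x ^ 2)⁻¹ := isBigO_twistedKernel hy μ b hs'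
  simp only [hterm]
  constructor
  · have hsum : Summable fun m : ℤ => |(m : ℝ)| ^ (-2 : ℝ) := Real.summable_abs_int_rpow one_lt_two
    have hshift : (fun x : ℝ => F (α + x)) =O[cocompact ℝ] fun x : ℝ => |x| ^ (-2 : ℝ) := by
      have h₁ := hFO.comp_tendsto (tendsto_top (f := fun x : ℝ => α + x) (l := cocompact ℝ))
      have h₂ := isBigO_inv_one_add_sub_sq (-α)
      refine h₁.trans ((h₂.congr_left fun x => ?_))
      simp [add_comm]
    exact (summable_of_isBigO hsum
      ((hshift.comp_tendsto Int.tendsto_coe_cofinite).const_mul_left A)).norm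
  · rw [tsum_mul_left, Real.tsum_eq_tsum_fourier_of_rpow_decay
      (continuous_twistedKernel hy s μ b (k + 1)) one_lt_two
      ((hFO.mono le_top).trans (by simpa using isBigO_inv_one_add_sub_sq 0))
      (isBigO_fourier_twistedKernel hy μ b hs') α, ← tsum_mul_left]
    refine tsum_congr fun l => ?_
    have hexp : Complex.exp (2 * Real.pi * Complex.I * α * ((l : ℝ) - μ)) =
        Complex.exp (-(2 * Real.pi * Complex.I * α * μ)) *
          Complex.exp (2 * Real.pi * Complex.I * l * α / (1 : ℝ)) := by
      rw [← Complex.exp_add]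
      congr 1
      push_cast
      ring
    rw [fourier_twistedKernel hy μ b hs', fourier_coe_apply, hexp, hA]
    simp only [hΦF, neg_sub]
    ring
end
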